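/- Let O ⊂ ℝⁿ (n ≥ 2) be a bounded open set, σ ∈ C¹(O) with σ > 0, and u ∈ C²(O) with div(σ∇u) = 0 in O. Fix x₀ ∈ O. Then the function r ↦ D(x₀,r) is differentiable on (0, dist(x₀,∂O)) and for every such r, ∂_r D(x₀,r) = ((n−2)/r) D(x₀,r) + (1/r) D̃(x₀,r) + 2 Ĥ(x₀,r), where D̃(x₀,r) = ∫_{B(x₀,r)} |∇u(x)|² ∇σ(x)·(x−x₀) dx and Ĥ(x₀,r) = ∫_{∂B(x₀,r)} σ (∂_ν u)² dS with ∂_ν u(x) = ∇u(x)·(x−x₀)/r. -/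

import Mathlib

open MeasureTheory Metric Set
open scoped RealInnerProductSpace

noncomputable section

abbrev Euc (n : ℕ) := EuclideanSpace ℝ (Fin n)

/-- Divergence of a vector field on `ℝⁿ`. -/
noncomputable def vdiv {n : ℕ} (F : Euc n → Euc n) (x : Euc n) : ℝ :=
  ∑ i, fderiv ℝ F x (EuclideanSpace.single i 1) i

/-- Surface integral over the sphere `∂B(x₀,r)`:
`∫_{∂B(x₀,r)} f dS = r^{n−1} ∫_{S^{n−1}} f(x₀+rθ) dσ(θ)`, where `σ` is the
surface measure `volume.toSphere` on the unit sphere. -/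
noncomputable def sphIntB (n : ℕ) (x₀ : Euc n) (r : ℝ) (f : Euc n → ℝ) : ℝ :=
  r ^ (n - 1) *
    ∫ θ : Metric.sphere (0 : Euc n) 1, f (x₀ + r • (θ : Euc n))
      ∂((volume : Measure (Euc n)).toSphere)

/-- `H(x₀,r) = ∫_{∂B(x₀,r)} σ u² dS`. -/
noncomputable def Hfn {n : ℕ} (σ u : Euc n → ℝ) (x₀ : Euc n) (r : ℝ) : ℝ :=
  sphIntB n x₀ r (fun y => σ y * u y ^ 2)

/-- `D(x₀,r) = ∫_{B(x₀,r)} σ |∇u|² dx`. -/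
noncomputable def Dfn {n : ℕ} (σ u : Euc n → ℝ) (x₀ : Euc n) (r : ℝ) : ℝ :=
  ∫ x in ball x₀ r, σ x * ‖gradient u x‖ ^ 2

/-- `K(x₀,r) = ∫_{B(x₀,r)} σ u² dx`. -/
noncomputable def Kfn {n : ℕ} (σ u : Euc n → ℝ) (x₀ : Euc n) (r : ℝ) : ℝ :=
  ∫ x in ball x₀ r, σ x * u x ^ 2

/-- `H̃(x₀,r) = ∫_{∂B(x₀,r)} u² ∇σ·ν dS`, with `ν(x₀+rθ) = θ`. -/
noncomputable def Htilde {n : ℕ} (σ u : Euc n → ℝ) (x₀ : Euc n) (r : ℝ) : ℝ :=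
  r ^ (n - 1) *
    ∫ θ : Metric.sphere (0 : Euc n) 1,
      u (x₀ + r • (θ : Euc n)) ^ 2 * ⟪gradient σ (x₀ + r • (θ : Euc n)), (θ : Euc n)⟫
      ∂((volume : Measure (Euc n)).toSphere)

/-- `Ĥ(x₀,r) = ∫_{∂B(x₀,r)} σ (∂_ν u)² dS`, with `∂_ν u(x₀+rθ) = ∇u(x₀+rθ)·θ`. -/
noncomputable def Hhat {n : ℕ} (σ u : Euc n → ℝ) (x₀ : Euc n) (r : ℝ) : ℝ :=
  r ^ (n - 1) *
    ∫ θ : Metric.sphere (0 : Euc n) 1,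
      σ (x₀ + r • (θ : Euc n)) * ⟪gradient u (x₀ + r • (θ : Euc n)), (θ : Euc n)⟫ ^ 2
      ∂((volume : Measure (Euc n)).toSphere)

/-- `D̃(x₀,r) = ∫_{B(x₀,r)} |∇u|² ∇σ·(x−x₀) dx`. -/
noncomputable def Dtilde {n : ℕ} (σ u : Euc n → ℝ) (x₀ : Euc n) (r : ℝ) : ℝ :=
  ∫ x in ball x₀ r, ‖gradient u x‖ ^ 2 * ⟪gradient σ x, x - x₀⟫

lemma hasDerivAt_max_zero_sq (t : ℝ) :
    HasDerivAt (fun s : ℝ => max 0 s ^ 2) (2 * max 0 t) t := by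
  rcases lt_trichotomy t 0 with ht | rfl | ht
  · have h : (fun s : ℝ => max 0 s ^ 2) =ᶠ[nhds t] fun _ => 0 := by
      filter_upwards [gt_mem_nhds ht] with s hs
      simp [max_eq_left hs.le]
    simpa [max_eq_left ht.le] using (hasDerivAt_const t (0 : ℝ)).congr_of_eventuallyEq h
  · rw [hasDerivAt_iff_isLittleO]
    have h : (fun s : ℝ => max 0 s ^ 2) =O[nhds 0] fun s => s ^ 2 := by
      refine Asymptotics.IsBigO.of_bound 1 (Filter.Eventually.of_forall fun s => ?_)
      rcases le_total s 0 with hs | hs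
      · simp [max_eq_left hs, sq_nonneg]
      · simp [max_eq_right hs]
    simpa using h.trans_isLittleO (Asymptotics.isLittleO_pow_id one_lt_two)
  · have h : (fun s : ℝ => max 0 s ^ 2) =ᶠ[nhds t] fun s => s ^ 2 := by
      filter_upwards [lt_mem_nhds ht] with s hs
      simp [max_eq_right hs.le]
    simpa [max_eq_right ht.le] using (hasDerivAt_pow 2 t).congr_of_eventuallyEq h

/-- If `(r² - t²)² f` and `4 (r² - t²) g` have equal integrals over `[0, r]` for all small `r`,
then `g r = r ∫₀ʳ f`. -/
lemma mul_intervalIntegral_eq_of_weighted_eq {f g : ℝ → ℝ} (hf : Continuous f)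
    (hg : Continuous g) {R : ℝ}
    (h : ∀ r ∈ Ioo 0 R, ∫ t in (0 : ℝ)..r, (r ^ 2 - t ^ 2) ^ 2 * f t
      = 4 * ∫ t in (0 : ℝ)..r, (r ^ 2 - t ^ 2) * g t) :
    ∀ r ∈ Ioo 0 R, r * ∫ t in (0 : ℝ)..r, f t = g r := by
  set F : ℝ → ℝ := fun r => ∫ t in (0 : ℝ)..r, f t with hF
  have hFd : ∀ t, HasDerivAt F (f t) t := fun t => hf.integral_hasStrictDerivAt 0 t |>.hasDerivAt
  have hFc : Continuous F := continuous_iff_continuousAt.2 fun t => (hFd t).continuousAt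
  set k : ℝ → ℝ := fun t => t * F t - g t with hk
  have hkc : Continuous k := by fun_prop
  have h₁ : ∀ r ∈ Ioo 0 R, ∫ t in (0 : ℝ)..r, (r ^ 2 - t ^ 2) * k t = 0 := by
    intro r hr
    have hparts := intervalIntegral.integral_mul_deriv_eq_deriv_mul (a := 0) (b := r)
      (u := fun t => (r ^ 2 - t ^ 2) ^ 2) (u' := fun t => -4 * ((r ^ 2 - t ^ 2) * t))
      (v := F) (v' := f)
      (fun t _ => by
        have := (((hasDerivAt_pow 2 t).const_sub (r ^ 2)).pow 2)
        refine this.congr_deriv ?_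
        push_cast
        ring)
      (fun t _ => hFd t) (Continuous.intervalIntegrable (by fun_prop) _ _)
      (hf.intervalIntegrable _ _)
    have hF0 : F 0 = 0 := by simp [hF]
    rw [h r hr, hF0] at hparts
    have e : ∀ t, (r ^ 2 - t ^ 2) * k t
        = -(1 / 4) * (-4 * ((r ^ 2 - t ^ 2) * t) * F t) - (r ^ 2 - t ^ 2) * g t := by
      intro t; simp only [hk]; ring
    simp_rw [e]
    rw [intervalIntegral.integral_sub (Continuous.intervalIntegrable (by fun_prop) _ _)
      (Continuous.intervalIntegrable (by fun_prop) _ _), intervalIntegral.integral_const_mul]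
    linarith
  set a : ℝ → ℝ := fun r => ∫ t in (0 : ℝ)..r, k t with ha
  have had : ∀ t, HasDerivAt a (k t) t := fun t => hkc.integral_hasStrictDerivAt 0 t |>.hasDerivAt
  have hbd : ∀ t, HasDerivAt (fun r => ∫ t in (0 : ℝ)..r, t ^ 2 * k t) (t ^ 2 * k t) t := fun t =>
    (show Continuous fun t : ℝ => t ^ 2 * k t by fun_prop).integral_hasStrictDerivAt 0 t
      |>.hasDerivAt
  have h₂ : ∀ r ∈ Ioo 0 R, a r = 0 := by
    intro r hr
    have hd := (((hasDerivAt_pow 2 r).mul (had r)).sub (hbd r))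
    have hz : HasDerivAt (fun _ : ℝ => (0 : ℝ)) _ r := hd.congr_of_eventuallyEq (by
      filter_upwards [isOpen_Ioo.mem_nhds hr] with s hs
      have := h₁ s hs
      simp_rw [sub_mul] at this
      rw [intervalIntegral.integral_sub (Continuous.intervalIntegrable (by fun_prop) _ _)
        (Continuous.intervalIntegrable (by fun_prop) _ _),
        intervalIntegral.integral_const_mul] at this
      simpa [ha] using this.symm)
    have := hz.unique (hasDerivAt_const r 0)
    have h0 : r * a r = 0 := by push_cast at this; linarith
    exact (mul_eq_zero.1 h0).resolve_left hr.1.ne'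
  intro r hr
  have hz : HasDerivAt (fun _ : ℝ => (0 : ℝ)) (k r) r := (had r).congr_of_eventuallyEq (by
    filter_upwards [isOpen_Ioo.mem_nhds hr] with s hs using (h₂ s hs).symm)
  have := hz.unique (hasDerivAt_const r 0)
  exact sub_eq_zero.1 this

lemma ball_subset_of_le_infDist_frontier {n : ℕ} {O : Set (Euc n)} (hO : IsOpen O) {x₀ : Euc n}
    (hx₀ : x₀ ∈ O) : ball x₀ (infDist x₀ (frontier O)) ⊆ O := by
  have hd : Disjoint (ball x₀ (infDist x₀ (frontier O))) (frontier O) := disjoint_ball_infDist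
  rcases le_or_gt (infDist x₀ (frontier O)) 0 with h | h
  · simp [ball_eq_empty.2 h]
  refine (convex_ball x₀ _).isPreconnected.subset_left_of_subset_union hO
    (isClosed_closure (s := O)).isOpen_compl ?_ ?_ ⟨x₀, mem_ball_self h, hx₀⟩
  · exact disjoint_compl_right.mono_left subset_closure
  · intro x hx
    by_contra hc
    simp only [mem_union, mem_compl_iff, not_or, not_not] at hc
    exact hd.le_bot ⟨hx, hc.2, by rw [hO.interior_eq]; exact hc.1⟩

lemma exists_continuous_eq_sphere_integral {n : ℕ} {x₀ : Euc n} {R : ℝ} (hR : 0 ≤ R)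
    {h : Euc n → ℝ} (hh : ContinuousOn h (closedBall x₀ R)) :
    ∃ s : ℝ → ℝ, Continuous s ∧ ∀ ρ ∈ Icc 0 R, s ρ = ρ ^ (n - 1) *
      ∫ θ : sphere (0 : Euc n) 1, h (x₀ + ρ • (θ : Euc n))
        ∂((volume : Measure (Euc n)).toSphere) := by
  set c : ℝ → ℝ := fun ρ => max 0 (min ρ R) with hc
  have hcc : Continuous c := by fun_prop
  have hmem : ∀ p : ℝ × sphere (0 : Euc n) 1, x₀ + c p.1 • (p.2 : Euc n) ∈ closedBall x₀ R := by
    intro p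
    have h0 : 0 ≤ c p.1 := le_max_left _ _
    have h1 : c p.1 ≤ R := max_le hR (min_le_right _ _)
    simpa [norm_smul, abs_of_nonneg h0] using h1
  have hcont : Continuous (Function.uncurry fun (ρ : ℝ) (θ : sphere (0 : Euc n) 1) =>
      h (x₀ + c ρ • (θ : Euc n))) :=
    hh.comp_continuous (f := fun p : ℝ × sphere (0 : Euc n) 1 => x₀ + c p.1 • (p.2 : Euc n))
      (by fun_prop) hmem
  refine ⟨fun ρ => ρ ^ (n - 1) * ∫ θ : sphere (0 : Euc n) 1, h (x₀ + c ρ • (θ : Euc n))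
        ∂((volume : Measure (Euc n)).toSphere), ?_, ?_⟩
  · have := continuous_parametric_integral_of_continuous
      (μ := (volume : Measure (Euc n)).toSphere) hcont isCompact_univ
    simp only [Measure.restrict_univ] at this
    fun_prop
  · intro ρ hρ
    simp [hc, min_eq_left hρ.2, max_eq_right hρ.1]

/-- Integration over a ball in polar coordinates. -/
lemma setIntegral_ball_eq_intervalIntegral_sphere {n : ℕ} (hn : n ≠ 0) {x₀ : Euc n} {r : ℝ}
    (hr : 0 ≤ r) {h : Euc n → ℝ} (hh : IntegrableOn h (ball x₀ r)) :
    ∫ x in ball x₀ r, h x = ∫ ρ in (0 : ℝ)..r, ρ ^ (n - 1) *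
      ∫ θ : sphere (0 : Euc n) 1, h (x₀ + ρ • (θ : Euc n))
        ∂((volume : Measure (Euc n)).toSphere) := by
  have : Nonempty (Fin n) := ⟨⟨0, Nat.pos_of_ne_zero hn⟩⟩
  set μ : Measure (Euc n) := volume
  set k : Euc n → ℝ := fun y => (ball x₀ r).indicator h (x₀ + y) with hk
  have hki : Integrable k μ :=
    ((integrable_indicator_iff measurableSet_ball).2 hh).comp_add_left x₀
  have hmp := μ.measurePreserving_homeomorphUnitSphereProd
  have hemb := (homeomorphUnitSphereProd (Euc n)).measurableEmbedding
  set q : sphere (0 : Euc n) 1 × Ioi (0 : ℝ) → ℝ := fun p => k ((p.2 : ℝ) • (p.1 : Euc n)) with hq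
  have hqk : ∀ x : ({0}ᶜ : Set (Euc n)), q (homeomorphUnitSphereProd (Euc n) x) = k x := by
    intro x
    have : ‖(x : Euc n)‖ ≠ 0 := norm_ne_zero_iff.2 x.2
    simp [hq, smul_smul, this]
  have hqi : Integrable q (μ.toSphere.prod (.volumeIoiPow (Module.finrank ℝ (Euc n) - 1))) := by
    rw [← hmp.integrable_comp_emb hemb]
    have : q ∘ (homeomorphUnitSphereProd (Euc n)) = k ∘ Subtype.val := funext hqk
    rw [this, ← integrableOn_iff_comap_subtypeVal (measurableSet_singleton _).compl]
    exact hki.integrableOn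
  calc ∫ x in ball x₀ r, h x = ∫ y, k y ∂μ := by
        rw [← integral_indicator measurableSet_ball, hk,
          integral_add_left_eq_self (fun y => (ball x₀ r).indicator h y)]
    _ = ∫ x : ({(0)}ᶜ : Set (Euc n)), k x ∂(μ.comap (↑)) := by
        rw [integral_subtype_comap (measurableSet_singleton _).compl k, restrict_compl_singleton]
    _ = ∫ p, q p ∂μ.toSphere.prod (.volumeIoiPow (Module.finrank ℝ (Euc n) - 1)) := by
        rw [← hmp.integral_comp hemb]
        exact integral_congr_ae (Filter.Eventually.of_forall fun x => (hqk x).symm)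
    _ = ∫ ρ : Ioi (0 : ℝ), ∫ θ, k ((ρ : ℝ) • (θ : Euc n)) ∂μ.toSphere
          ∂(.volumeIoiPow (n - 1)) := by
        rw [integral_prod_symm _ hqi, finrank_euclideanSpace_fin]
    _ = ∫ ρ in Ioi (0 : ℝ), ρ ^ (n - 1) * ∫ θ, k (ρ • (θ : Euc n)) ∂μ.toSphere := by
        simp only [Measure.volumeIoiPow, ENNReal.ofReal]
        rw [integral_withDensity_eq_integral_smul
          (measurable_subtype_coe.pow_const _).real_toNNReal,
          integral_subtype_comap measurableSet_Ioi fun a : ℝ =>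
            Real.toNNReal (a ^ (n - 1)) • ∫ θ, k (a • (θ : Euc n)) ∂μ.toSphere]
        refine setIntegral_congr_fun measurableSet_Ioi fun x hx => ?_
        simp only [NNReal.smul_def, Real.coe_toNNReal _ (pow_nonneg (le_of_lt hx) _), smul_eq_mul]
    _ = ∫ ρ in Ioi (0 : ℝ), (Iio r).indicator (fun ρ => ρ ^ (n - 1) *
          ∫ θ : sphere (0 : Euc n) 1, h (x₀ + ρ • (θ : Euc n)) ∂μ.toSphere) ρ := by
        refine setIntegral_congr_fun measurableSet_Ioi fun ρ (hρ : 0 < ρ) => ?_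
        by_cases hρr : ρ < r
        · simp [hk, indicator, hρr, norm_smul, abs_of_pos hρ]
        · simp [hk, indicator, hρr, norm_smul, abs_of_pos hρ]
    _ = _ := by
        rw [setIntegral_indicator measurableSet_Iio, intervalIntegral.integral_of_le hr,
          integral_Ioc_eq_integral_Ioo]
        rfl

lemma fderiv_apply_coord {n : ℕ} {V : Euc n → Euc n} {x : Euc n} (hV : DifferentiableAt ℝ V x)
    (v : Euc n) (i : Fin n) : fderiv ℝ (fun y => V y i) x v = fderiv ℝ V x v i := by
  have h := ((EuclideanSpace.proj (𝕜 := ℝ) i).hasFDerivAt (x := V x)).comp x hV.hasFDerivAt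
  exact congrArg (fun L => L v) h.fderiv

lemma ContDiffOn.continuousOn_vdiv {n : ℕ} {V : Euc n → Euc n} {O : Set (Euc n)} (hO : IsOpen O)
    (hV : ContDiffOn ℝ 1 V O) : ContinuousOn (vdiv V) O := by
  have := hV.continuousOn_fderiv_of_isOpen hO le_rfl
  unfold vdiv
  fun_prop

lemma integral_weight_mul_vdiv {n : ℕ} {V : Euc n → Euc n} {O : Set (Euc n)} (hO : IsOpen O)
    (hV : ContDiffOn ℝ 1 V O) {x₀ : Euc n} {r : ℝ} (hr : 0 ≤ r) (hrO : closedBall x₀ r ⊆ O) :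
    ∫ x in ball x₀ r, (r ^ 2 - ‖x - x₀‖ ^ 2) ^ 2 * vdiv V x
      = 4 * ∫ x in ball x₀ r, (r ^ 2 - ‖x - x₀‖ ^ 2) * ⟪V x, x - x₀⟫ := by
  set m : Euc n → ℝ := fun x => max 0 (r ^ 2 - ‖x - x₀‖ ^ 2) with hm
  have hmc : Continuous m := by fun_prop
  have hm0 : ∀ x ∉ ball x₀ r, m x = 0 := by
    intro x hx
    rw [mem_ball, dist_eq_norm, not_lt] at hx
    have : r ^ 2 ≤ ‖x - x₀‖ ^ 2 := by gcongr
    exact max_eq_left (by linarith)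
  have hm1 : ∀ x ∈ ball x₀ r, m x = r ^ 2 - ‖x - x₀‖ ^ 2 := by
    intro x hx
    rw [mem_ball, dist_eq_norm] at hx
    have : ‖x - x₀‖ ^ 2 ≤ r ^ 2 := by gcongr
    exact max_eq_right (by linarith)
  have hη : ∀ x, HasFDerivAt (fun y => m y ^ 2) ((-4 * m x) • innerSL ℝ (x - x₀)) x := by
    intro x
    have h₁ : HasFDerivAt (fun y => r ^ 2 - ‖y - x₀‖ ^ 2) (-(2 • innerSL ℝ (x - x₀))) x := by
      have := ((hasFDerivAt_id x).sub_const x₀).norm_sq.const_sub (r ^ 2)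
      simpa using this
    have h₂ := (hasDerivAt_max_zero_sq (r ^ 2 - ‖x - x₀‖ ^ 2)).comp_hasFDerivAt x h₁
    refine h₂.congr_fderiv ?_
    ext v
    simp [hm]
    ring
  have hint : ∀ f : Euc n → ℝ, ContinuousOn f (closedBall x₀ r) → (∀ x ∉ ball x₀ r, f x = 0) →
      Integrable f := by
    intro f hf hf0
    refine (integrableOn_iff_integrable_of_support_subset (s := closedBall x₀ r) ?_).1
      (hf.integrableOn_compact (isCompact_closedBall _ _))
    intro x hx
    by_contra hc
    exact hx (hf0 x fun h => hc (ball_subset_closedBall h))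
  have hVc : ContinuousOn V (closedBall x₀ r) := hV.continuousOn.mono hrO
  have hV'c : ContinuousOn (fderiv ℝ V) (closedBall x₀ r) :=
    (hV.continuousOn_fderiv_of_isOpen hO le_rfl).mono hrO
  have hVd : ∀ x ∈ closedBall x₀ r, DifferentiableAt ℝ V x := fun x hx =>
    (hV.differentiableOn one_ne_zero).differentiableAt (hO.mem_nhds (hrO hx))
  have hsupp : tsupport (fun y => m y ^ 2) ⊆ closedBall x₀ r := by
    refine closure_minimal (fun x hx => ?_) isClosed_closedBall
    by_contra hc
    exact hx (by simp [hm0 x fun h => hc (ball_subset_closedBall h)])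
  have hi₁ : ∀ i, Integrable fun x =>
      m x ^ 2 * fderiv ℝ V x (EuclideanSpace.single i 1) i := fun i =>
    hint _ (by fun_prop) fun x hx => by simp [hm0 x hx]
  have hi₂ : ∀ i, Integrable fun x => m x * (V x i * (x - x₀) i) := fun i =>
    hint _ (by fun_prop) fun x hx => by simp [hm0 x hx]
  have hparts : ∀ i, ∫ x, m x ^ 2 * fderiv ℝ V x (EuclideanSpace.single i 1) i
      = 4 * ∫ x, m x * (V x i * (x - x₀) i) := by
    intro i
    have e₁ : (fun x => m x ^ 2 * fderiv ℝ (fun y => V y i) x (EuclideanSpace.single i 1))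
        = fun x => m x ^ 2 * fderiv ℝ V x (EuclideanSpace.single i 1) i := by
      ext x
      by_cases hx : x ∈ ball x₀ r
      · rw [fderiv_apply_coord (hVd x (ball_subset_closedBall hx))]
      · simp [hm0 x hx]
    have e₂ : (fun x => fderiv ℝ (fun y => m y ^ 2) x (EuclideanSpace.single i 1) * V x i)
        = fun x => -4 * (m x * (V x i * (x - x₀) i)) := by
      ext x
      rw [(hη x).fderiv]
      simp [EuclideanSpace.inner_single_right]
      ring
    have := integral_mul_fderiv_eq_neg_fderiv_mul_of_integrable (μ := (volume : Measure (Euc n)))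
      (f := fun y => m y ^ 2) (g := fun y => V y i) (v := EuclideanSpace.single i 1)
      (by rw [e₂]; exact (hi₂ i).const_mul _) (by rw [e₁]; exact hi₁ i)
      (hint _ (by fun_prop) fun x hx => by simp [hm0 x hx])
      (fun x _ => (hη x).differentiableAt)
      (fun x hx => by have := hVd x (hsupp hx); fun_prop)
    rw [e₁, e₂, integral_const_mul] at this
    linarith
  have hL : ∫ x in ball x₀ r, (r ^ 2 - ‖x - x₀‖ ^ 2) ^ 2 * vdiv V x
      = ∫ x, m x ^ 2 * vdiv V x := by
    rw [← setIntegral_eq_integral_of_forall_compl_eq_zero (s := ball x₀ r)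
      (f := fun x => m x ^ 2 * vdiv V x)
      fun x hx => by simp [hm0 x hx]]
    exact setIntegral_congr_fun measurableSet_ball fun x hx => by simp only [hm1 x hx]
  have hRt : ∫ x in ball x₀ r, (r ^ 2 - ‖x - x₀‖ ^ 2) * ⟪V x, x - x₀⟫
      = ∫ x, m x * ⟪V x, x - x₀⟫ := by
    rw [← setIntegral_eq_integral_of_forall_compl_eq_zero (s := ball x₀ r)
      (f := fun x => m x * ⟪V x, x - x₀⟫)
      fun x hx => by simp [hm0 x hx]]
    exact setIntegral_congr_fun measurableSet_ball fun x hx => by simp only [hm1 x hx]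
  have hinner : ∀ x, ⟪V x, x - x₀⟫ = ∑ i, V x i * (x - x₀) i := fun x => by
    simp [PiLp.inner_apply, mul_comm]
  rw [hL, hRt]
  simp_rw [hinner, vdiv, Finset.mul_sum]
  rw [integral_finsetSum _ fun i _ => hi₁ i, integral_finsetSum _ fun i _ => hi₂ i,
    Finset.mul_sum]
  exact Finset.sum_congr rfl fun i _ => hparts i

/-- The divergence theorem on a ball. -/
theorem mul_integral_ball_vdiv {n : ℕ} (hn : n ≠ 0) {V : Euc n → Euc n} {O : Set (Euc n)}
    (hO : IsOpen O) (hV : ContDiffOn ℝ 1 V O) {x₀ : Euc n} {R : ℝ} (hRO : closedBall x₀ R ⊆ O)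
    {r : ℝ} (hr : r ∈ Ioo 0 R) :
    r * ∫ x in ball x₀ r, vdiv V x = sphIntB n x₀ r fun x => ⟪V x, x - x₀⟫ := by
  have hR : 0 ≤ R := (hr.1.trans hr.2).le
  have hVc : ContinuousOn V (closedBall x₀ R) := hV.continuousOn.mono hRO
  have hdc : ContinuousOn (vdiv V) (closedBall x₀ R) := (hV.continuousOn_vdiv hO).mono hRO
  have hic : ContinuousOn (fun x => ⟪V x, x - x₀⟫) (closedBall x₀ R) := by fun_prop
  have polar : ∀ (p : ℝ → ℝ) (h : Euc n → ℝ) (s : ℝ → ℝ), Continuous p →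
      ContinuousOn h (closedBall x₀ R) →
      (∀ ρ ∈ Icc 0 R, s ρ = ρ ^ (n - 1) *
        ∫ θ : sphere (0 : Euc n) 1, h (x₀ + ρ • (θ : Euc n))
          ∂((volume : Measure (Euc n)).toSphere)) →
      ∀ t ∈ Ioo 0 R, ∫ x in ball x₀ t, p ‖x - x₀‖ * h x = ∫ ρ in (0 : ℝ)..t, p ρ * s ρ := by
    intro p h s hp hh hs t ht
    rw [setIntegral_ball_eq_intervalIntegral_sphere hn ht.1.le]
    · refine intervalIntegral.integral_congr fun ρ hρ => ?_
      rw [uIcc_of_le ht.1.le] at hρ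
      simp only [add_sub_cancel_left, norm_smul, norm_eq_of_mem_sphere, mul_one,
        Real.norm_of_nonneg hρ.1]
      rw [integral_const_mul, hs ρ ⟨hρ.1, hρ.2.trans ht.2.le⟩]
      ring
    · refine (ContinuousOn.integrableOn_compact (isCompact_closedBall x₀ R) ?_).mono_set
        (ball_subset_closedBall.trans (closedBall_subset_closedBall ht.2.le))
      fun_prop
  obtain ⟨f, hf, hfe⟩ := exists_continuous_eq_sphere_integral hR hdc
  obtain ⟨g, hg, hge⟩ := exists_continuous_eq_sphere_integral hR hic
  have key := mul_intervalIntegral_eq_of_weighted_eq hf hg (R := R) (fun t ht => by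
    rw [← polar (fun ρ => (t ^ 2 - ρ ^ 2) ^ 2) _ f (by fun_prop) hdc hfe t ht,
      ← polar (fun ρ => t ^ 2 - ρ ^ 2) _ g (by fun_prop) hic hge t ht]
    exact integral_weight_mul_vdiv hO hV ht.1.le
      ((closedBall_subset_closedBall ht.2.le).trans hRO)) r hr
  have h₁ := polar (fun _ => 1) _ f continuous_const hdc hfe r hr
  simp only [one_mul] at h₁
  rw [h₁, key, hge r ⟨hr.1.le, hr.2.le⟩, sphIntB]

lemma hasDerivAt_integral_ball {n : ℕ} (hn : n ≠ 0) {x₀ : Euc n} {R : ℝ} {h : Euc n → ℝ}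
    (hh : ContinuousOn h (closedBall x₀ R)) {r : ℝ} (hr : r ∈ Ioo 0 R) :
    HasDerivAt (fun ρ => ∫ x in ball x₀ ρ, h x) (sphIntB n x₀ r h) r := by
  obtain ⟨s, hs, hse⟩ := exists_continuous_eq_sphere_integral (hr.1.trans hr.2).le hh
  rw [sphIntB, ← hse r ⟨hr.1.le, hr.2.le⟩]
  refine (hs.integral_hasStrictDerivAt 0 r).hasDerivAt.congr_of_eventuallyEq ?_
  filter_upwards [isOpen_Ioo.mem_nhds hr] with t ht
  rw [setIntegral_ball_eq_intervalIntegral_sphere hn ht.1.le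
    ((hh.integrableOn_compact (isCompact_closedBall x₀ R)).mono_set
      (ball_subset_closedBall.trans (closedBall_subset_closedBall ht.2.le)))]
  refine intervalIntegral.integral_congr fun ρ hρ => ?_
  rw [uIcc_of_le ht.1.le] at hρ
  exact (hse ρ ⟨hρ.1, hρ.2.trans ht.2.le⟩).symm

lemma vdiv_smul {n : ℕ} {φ : Euc n → ℝ} {F : Euc n → Euc n} {x : Euc n}
    (hφ : DifferentiableAt ℝ φ x) (hF : DifferentiableAt ℝ F x) :
    vdiv (fun y => φ y • F y) x = φ x * vdiv F x + fderiv ℝ φ x (F x) := by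
  have hsum : fderiv ℝ φ x (F x) = ∑ i, F x i * fderiv ℝ φ x (EuclideanSpace.single i 1) := by
    conv_lhs => rw [← (EuclideanSpace.basisFun (Fin n) ℝ).sum_repr (F x)]
    simp
  simp only [vdiv, fderiv_fun_smul hφ hF, hsum, Finset.mul_sum, ← Finset.sum_add_distrib]
  exact Finset.sum_congr rfl fun i _ => by simp [mul_comm]

lemma vdiv_sub {n : ℕ} {F G : Euc n → Euc n} {x : Euc n}
    (hF : DifferentiableAt ℝ F x) (hG : DifferentiableAt ℝ G x) :
    vdiv (fun y => F y - G y) x = vdiv F x - vdiv G x := by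
  simp [vdiv, fderiv_fun_sub hF hG]

lemma vdiv_sub_const_self {n : ℕ} (x₀ x : Euc n) : vdiv (fun y => y - x₀) x = n := by
  simp [vdiv, fderiv_sub_const]

lemma ContDiffOn.gradient {n : ℕ} {u : Euc n → ℝ} {O : Set (Euc n)} (hO : IsOpen O)
    (hu : ContDiffOn ℝ 2 u O) : ContDiffOn ℝ 1 (gradient u) O :=
  (InnerProductSpace.toDual ℝ (Euc n)).symm.contDiff.comp_contDiffOn
    (hu.fderiv_of_isOpen hO (by norm_num))

lemma inner_fderiv_gradient_comm {n : ℕ} {u : Euc n → ℝ} {x : Euc n}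
    (hu : ContDiffAt ℝ 2 u x) (v w : Euc n) :
    ⟪fderiv ℝ (gradient u) x v, w⟫ = ⟪fderiv ℝ (gradient u) x w, v⟫ := by
  have hd : DifferentiableAt ℝ (fderiv ℝ u) x :=
    (hu.fderiv_right (m := 1) (by norm_num)).differentiableAt one_ne_zero
  have h : ∀ a b, ⟪fderiv ℝ (gradient u) x a, b⟫ = fderiv ℝ (fderiv ℝ u) x a b := by
    intro a b
    have := ((InnerProductSpace.toDual ℝ (Euc n)).symm.toContinuousLinearEquiv.hasFDerivAt
      (x := fderiv ℝ u x)).comp x hd.hasFDerivAt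
    have e : fderiv ℝ (gradient u) x = _ := this.fderiv
    rw [e]
    exact InnerProductSpace.toDual_symm_apply
  rw [h, h]
  exact hu.isSymmSndFDerivAt (by simp) v w

/-- The Rellich–Pohozaev vector field `σ |∇u|² (x - x₀) - 2 σ (∇u · (x - x₀)) ∇u`. -/
def rellichField {n : ℕ} (σ u : Euc n → ℝ) (x₀ : Euc n) (x : Euc n) : Euc n :=
  (σ x * ‖gradient u x‖ ^ 2) • (x - x₀)
    - (2 * ⟪gradient u x, x - x₀⟫) • (σ x • gradient u x)

lemma vdiv_rellichField {n : ℕ} {σ u : Euc n → ℝ} {x₀ x : Euc n} (hσ : DifferentiableAt ℝ σ x)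
    (hu : ContDiffAt ℝ 2 u x) (hG : DifferentiableAt ℝ (gradient u) x)
    (hpde : vdiv (fun y => σ y • gradient u y) x = 0) :
    vdiv (rellichField σ u x₀) x = ((n : ℝ) - 2) * (σ x * ‖gradient u x‖ ^ 2)
      + ‖gradient u x‖ ^ 2 * ⟪gradient σ x, x - x₀⟫ := by
  have hX : DifferentiableAt ℝ (fun y => y - x₀) x := by fun_prop
  have hnsq : DifferentiableAt ℝ (fun y => ‖gradient u y‖ ^ 2) x := hG.norm_sq ℝ
  have hi : DifferentiableAt ℝ (fun y => ⟪gradient u y, y - x₀⟫) x := hG.inner ℝ hX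
  have hφ : DifferentiableAt ℝ (fun y => σ y * ‖gradient u y‖ ^ 2) x := hσ.mul hnsq
  have hψ : DifferentiableAt ℝ (fun y => 2 * ⟪gradient u y, y - x₀⟫) x := hi.const_mul 2
  have hA : DifferentiableAt ℝ (fun y => σ y • gradient u y) x := hσ.smul hG
  have h₁ : fderiv ℝ (fun y => σ y * ‖gradient u y‖ ^ 2) x (x - x₀)
      = σ x * (2 * ⟪fderiv ℝ (gradient u) x (x - x₀), gradient u x⟫)
        + ‖gradient u x‖ ^ 2 * ⟪gradient σ x, x - x₀⟫ := by
    rw [fderiv_fun_mul hσ hnsq, (hG.hasFDerivAt.norm_sq).fderiv,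
      real_inner_comm (gradient u x)]
    simp
  have h₂ : fderiv ℝ (fun y => 2 * ⟪gradient u y, y - x₀⟫) x (σ x • gradient u x)
      = 2 * σ x * (‖gradient u x‖ ^ 2
        + ⟪fderiv ℝ (gradient u) x (x - x₀), gradient u x⟫) := by
    have h₃ : fderiv ℝ (fun y => ⟪gradient u y, y - x₀⟫) x (gradient u x)
        = ‖gradient u x‖ ^ 2 + ⟪fderiv ℝ (gradient u) x (x - x₀), gradient u x⟫ := by
      rw [fderiv_inner_apply ℝ hG hX, inner_fderiv_gradient_comm hu, fderiv_sub_const]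
      simp
    rw [map_smul, fderiv_const_mul hi]
    rw [smul_apply, h₃, smul_eq_mul, smul_eq_mul]
    ring
  unfold rellichField
  rw [vdiv_sub (hφ.fun_smul hX) (hψ.fun_smul hA), vdiv_smul hφ hX, vdiv_smul hψ hA, hpde,
    vdiv_sub_const_self, h₁, h₂]
  ring

/-- Derivative of `D`: `D' = ((n−2)/r) D + (1/r) D̃ + 2Ĥ`
(Rellich–Pohozaev identity). -/
theorem stmt12 (n : ℕ) (hn : 2 ≤ n) (O : Set (Euc n)) (hO : IsOpen O)
    (hObd : Bornology.IsBounded O) (σ u : Euc n → ℝ)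
    (hσ : ContDiffOn ℝ 1 σ O) (hσpos : ∀ x ∈ O, 0 < σ x)
    (hu : ContDiffOn ℝ 2 u O)
    (hpde : ∀ x ∈ O, vdiv (fun y => σ y • gradient u y) x = 0)
    (x₀ : Euc n) (hx₀ : x₀ ∈ O) :
    ∀ r ∈ Ioo (0 : ℝ) (infDist x₀ (frontier O)),
      HasDerivAt (fun ρ => Dfn σ u x₀ ρ)
        (((n : ℝ) - 2) / r * Dfn σ u x₀ r + (1 / r) * Dtilde σ u x₀ r
          + 2 * Hhat σ u x₀ r) r := by
  intro r hr
  have hn0 : n ≠ 0 := by omega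
  obtain ⟨R, hrR, hR⟩ := exists_between hr.2
  have hrm : r ∈ Ioo 0 R := ⟨hr.1, hrR⟩
  have hRO : closedBall x₀ R ⊆ O :=
    (closedBall_subset_ball hR).trans (ball_subset_of_le_infDist_frontier hO hx₀)
  have hG : ContDiffOn ℝ 1 (gradient u) O := hu.gradient hO
  have hσc : ContinuousOn σ (closedBall x₀ R) := hσ.continuousOn.mono hRO
  have hGc : ContinuousOn (gradient u) (closedBall x₀ R) := hG.continuousOn.mono hRO
  have hgσc : ContinuousOn (gradient σ) (closedBall x₀ R) :=
    (InnerProductSpace.toDual ℝ (Euc n)).symm.continuous.comp_continuousOn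
      ((hσ.continuousOn_fderiv_of_isOpen hO le_rfl).mono hRO)
  have hdens : ContinuousOn (fun x => σ x * ‖gradient u x‖ ^ 2) (closedBall x₀ R) := by fun_prop
  have hV : ContDiffOn ℝ 1 (rellichField σ u x₀) O := by
    have hX : ContDiffOn ℝ 1 (fun x => x - x₀) O := by fun_prop
    exact ((hσ.mul (hG.norm_sq ℝ)).smul hX).sub
      ((contDiffOn_const.mul (hG.inner ℝ hX)).smul (hσ.smul hG))
  have hint : ∀ h : Euc n → ℝ, ContinuousOn h (closedBall x₀ R) → IntegrableOn h (ball x₀ r) :=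
    fun h hh => (hh.integrableOn_compact (isCompact_closedBall x₀ R)).mono_set
      (ball_subset_closedBall.trans (closedBall_subset_closedBall hrR.le))
  have hmem : ∀ θ : sphere (0 : Euc n) 1, x₀ + r • (θ : Euc n) ∈ closedBall x₀ R := fun θ => by
    simpa [norm_smul, abs_of_pos hr.1] using hrR.le
  have hdiv : ∫ x in ball x₀ r, vdiv (rellichField σ u x₀) x
      = ((n : ℝ) - 2) * Dfn σ u x₀ r + Dtilde σ u x₀ r := by
    rw [Dfn, Dtilde, ← integral_const_mul, ← integral_add
      ((hint _ hdens).const_mul _) (hint _ (by fun_prop))]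
    refine setIntegral_congr_fun measurableSet_ball fun x hx => ?_
    have hxO := hO.mem_nhds (hRO (closedBall_subset_closedBall hrR.le (ball_subset_closedBall hx)))
    exact vdiv_rellichField ((hσ.contDiffAt hxO).differentiableAt one_ne_zero)
      (hu.contDiffAt hxO) ((hG.contDiffAt hxO).differentiableAt one_ne_zero)
      (hpde x (mem_of_mem_nhds hxO))
  have hflux : (sphIntB n x₀ r fun x => ⟪rellichField σ u x₀ x, x - x₀⟫)
      = r ^ 2 * (sphIntB n x₀ r fun x => σ x * ‖gradient u x‖ ^ 2)
        - 2 * r ^ 2 * Hhat σ u x₀ r := by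
    have hpt : ∀ θ : sphere (0 : Euc n) 1,
        ⟪rellichField σ u x₀ (x₀ + r • (θ : Euc n)), x₀ + r • (θ : Euc n) - x₀⟫
        = r ^ 2 * (σ (x₀ + r • (θ : Euc n)) * ‖gradient u (x₀ + r • (θ : Euc n))‖ ^ 2)
          - 2 * r ^ 2 * (σ (x₀ + r • (θ : Euc n))
            * ⟪gradient u (x₀ + r • (θ : Euc n)), (θ : Euc n)⟫ ^ 2) := by
      intro θ
      simp only [rellichField, add_sub_cancel_left, inner_sub_left, real_inner_smul_left,
        real_inner_smul_right, real_inner_self_eq_norm_sq, norm_eq_of_mem_sphere]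
      ring
    have hσs := hσc.comp_continuous (by fun_prop) hmem
    have hGs := hGc.comp_continuous (by fun_prop) hmem
    have hic : ∀ f : sphere (0 : Euc n) 1 → ℝ, Continuous f →
        Integrable f (volume : Measure (Euc n)).toSphere := fun f hf =>
      hf.integrable_of_hasCompactSupport (HasCompactSupport.of_compactSpace f)
    have hi₁ : Integrable (fun θ : sphere (0 : Euc n) 1 => σ (x₀ + r • (θ : Euc n))
        * ‖gradient u (x₀ + r • (θ : Euc n))‖ ^ 2) (volume : Measure (Euc n)).toSphere :=
      hic _ (hσs.mul (hGs.norm.pow 2))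
    have hi₂ : Integrable (fun θ : sphere (0 : Euc n) 1 => σ (x₀ + r • (θ : Euc n))
        * ⟪gradient u (x₀ + r • (θ : Euc n)), (θ : Euc n)⟫ ^ 2)
        (volume : Measure (Euc n)).toSphere :=
      hic _ (hσs.mul ((hGs.inner continuous_subtype_val).pow 2))
    simp only [sphIntB, Hhat, hpt]
    rw [integral_sub (hi₁.const_mul _) (hi₂.const_mul _),
      integral_const_mul, integral_const_mul]
    ring
  have hdt := mul_integral_ball_vdiv hn0 hO hV hRO hrm
  rw [hdiv, hflux] at hdt
  refine (hasDerivAt_integral_ball hn0 hdens hrm).congr_deriv ?_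
  have hr0 := hr.1.ne'
  field_simp
  refine mul_left_cancel₀ hr0 ?_
  linarith

end
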